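/- arXiv:2003.05230 — 10 statements merged into one kernel-verified Lean document; each statement's English description precedes it below -/
import Mathlib

section
/- Let A, B, C be n×n positive semidefinite complex matrices and let r be a positive integer. Then ⊗^r(A+B+C) + ⊗^r A + ⊗^r B + ⊗^r C ≥ ⊗^r(A+B) + ⊗^r(A+C) + ⊗^r(B+C) in the Löwner order, i.e., the matrix ⊗^r(A+B+C) + ⊗^r A + ⊗^r B + ⊗^r C − ⊗^r(A+B) − ⊗^r(A+C) − ⊗^r(B+C) is positive semidefinite. -/
open Matrix BigOperators
open scoped ComplexOrder

/-- The `r`-fold Kronecker (tensor) power of an `n × n` matrix, indexed by tuples. -/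
def tensorPow {n : ℕ} (r : ℕ) (X : Matrix (Fin n) (Fin n) ℂ) :
    Matrix (Fin r → Fin n) (Fin r → Fin n) ℂ :=
  Matrix.of fun x y => ∏ k : Fin r, X (x k) (y k)

/-- One step of the tensor power: `X ⊗ M`, indexed by tuples of length `r + 1`. -/
def stepProd {n r : ℕ} (X : Matrix (Fin n) (Fin n) ℂ)
    (M : Matrix (Fin r → Fin n) (Fin r → Fin n) ℂ) :
    Matrix (Fin (r + 1) → Fin n) (Fin (r + 1) → Fin n) ℂ :=
  (X.submatrix (fun x => x 0) (fun x => x 0)) ⊙ (M.submatrix Fin.tail Fin.tail)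

theorem tensorPow_succ {n : ℕ} (r : ℕ) (X : Matrix (Fin n) (Fin n) ℂ) :
    tensorPow (r + 1) X = stepProd X (tensorPow r X) := by
  ext x y
  simp [tensorPow, stepProd, Fin.prod_univ_succ, Fin.tail]

theorem stepProd_pos {n r : ℕ} {X : Matrix (Fin n) (Fin n) ℂ}
    {M : Matrix (Fin r → Fin n) (Fin r → Fin n) ℂ}
    (hX : X.PosSemidef) (hM : M.PosSemidef) : (stepProd X M).PosSemidef :=
  (hX.submatrix _).hadamard (hM.submatrix _)

theorem tensorPow_pos {n : ℕ} (r : ℕ) {X : Matrix (Fin n) (Fin n) ℂ}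
    (hX : X.PosSemidef) : (tensorPow r X).PosSemidef := by
  induction r with
  | zero =>
    have h : tensorPow 0 X = 1 := by
      ext x y
      obtain rfl := Subsingleton.elim x y
      simp [tensorPow]
    rw [h]
    exact Matrix.PosSemidef.one
  | succ r ih =>
    rw [tensorPow_succ]
    exact stepProd_pos hX ih

theorem first_diff {n : ℕ} (r : ℕ) {X Y : Matrix (Fin n) (Fin n) ℂ}
    (hX : X.PosSemidef) (hY : Y.PosSemidef) :
    (tensorPow r (X + Y) - tensorPow r X).PosSemidef := by
  induction r with
  | zero =>
    convert Matrix.PosSemidef.zero using 1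
    ext x y
    simp [tensorPow]
  | succ r ih =>
    convert (stepProd_pos hX ih).add (stepProd_pos hY (tensorPow_pos r (hX.add hY))) using 1
    ext x y
    simp [stepProd, tensorPow_succ]
    ring

theorem second_diff {n : ℕ} (r : ℕ) {X Y Z : Matrix (Fin n) (Fin n) ℂ}
    (hX : X.PosSemidef) (hY : Y.PosSemidef) (hZ : Z.PosSemidef) :
    (tensorPow r (X + Y + Z) + tensorPow r X - tensorPow r (X + Y)
      - tensorPow r (X + Z)).PosSemidef := by
  induction r with
  | zero =>
    convert Matrix.PosSemidef.zero using 1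
    ext x y
    simp [tensorPow]
  | succ r ih =>
    have h2 := first_diff r (hX.add hZ) hY
    rw [add_right_comm] at h2
    convert ((stepProd_pos hX ih).add (stepProd_pos hY (first_diff r (hX.add hY) hZ))).add
      (stepProd_pos hZ h2) using 1
    ext x y
    simp [stepProd, tensorPow_succ]
    ring

theorem tensorPow_superadditive_three {n : ℕ} (A B C : Matrix (Fin n) (Fin n) ℂ)
    (hA : A.PosSemidef) (hB : B.PosSemidef) (hC : C.PosSemidef) (r : ℕ) (hr : 0 < r) :
    (tensorPow r (A + B + C) + tensorPow r A + tensorPow r B + tensorPow r C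
      - tensorPow r (A + B) - tensorPow r (A + C) - tensorPow r (B + C)).PosSemidef := by
  obtain ⟨r, rfl⟩ : ∃ k, r = k + 1 := ⟨r - 1, by omega⟩
  have h := ((stepProd_pos hA (second_diff r hA hB hC)).add
    (stepProd_pos hB (second_diff r hB hA hC))).add (stepProd_pos hC (second_diff r hC hA hB))
  rw [show B + A + C = A + B + C by abel, show C + A + B = A + B + C by abel,
    add_comm B A, add_comm C A, add_comm C B] at h
  convert h using 1
  ext x y
  simp [stepProd, tensorPow_succ]
  ring
end

section
/- Let A = [A_ij], B = [B_ij], C = [C_ij] ∈ M_m(M_n) be positive semidefinite block matrices. Then det₂(A+B+C) + det₂(A) + det₂(B) + det₂(C) ≥ det₂(A+B) + det₂(A+C) + det₂(B+C) in the Löwner order, i.e., the m×m matrix det₂(A+B+C) + det₂(A) + det₂(B) + det₂(C) − det₂(A+B) − det₂(A+C) − det₂(B+C) is positive semidefinite. -/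
open Matrix BigOperators
open scoped ComplexOrder

/-- The second partial determinant of a block matrix `A ∈ M_m(M_n)`:
the `m × m` matrix `[det A_ij]`. -/
noncomputable def det2 {m n : ℕ} (A : Matrix (Fin m × Fin n) (Fin m × Fin n) ℂ) :
    Matrix (Fin m) (Fin m) ℂ :=
  Matrix.of fun i j => (Matrix.of fun r s => A (i, r) (j, s)).det

open scoped MatrixOrder in
lemma psd_factor {ι : Type*} [Fintype ι] [DecidableEq ι] {A : Matrix ι ι ℂ}
    (hA : A.PosSemidef) : ∃ X : Matrix ι ι ℂ, A = Xᴴ * X :=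
  CStarAlgebra.nonneg_iff_eq_star_mul_self.mp hA.nonneg

lemma cb_det {n : ℕ} {K : Type*} [Fintype K] [DecidableEq K] (w : K → ℂ)
    (x y : K → Fin n → ℂ) :
    (n.factorial : ℂ) * (Matrix.of fun r s => ∑ k, w k * (x k r * y k s)).det
      = ∑ f : Fin n → K, (∏ t, w (f t)) *
        ((Matrix.of fun t r => x (f t) r).det * (Matrix.of fun t r => y (f t) r).det) := by
  set M : Matrix (Fin n) (Fin n) ℂ := Matrix.of fun r s => ∑ k, w k * (x k r * y k s) with hM
  have h1 : ∀ σ : Equiv.Perm (Fin n), (M.submatrix σ id).det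
      = ∑ f : Fin n → K, (∏ t, w (f t) * x (f t) (σ t)) * (Matrix.of fun t r => y (f t) r).det := by
    intro σ
    have e : M.submatrix σ id = fun t => ∑ k, (w k * x k (σ t)) • y k := by
      ext t s
      simp [hM, Finset.sum_apply, mul_assoc]
    have := (Matrix.detRowAlternating (R := ℂ) (n := Fin n)).toMultilinearMap.map_sum
      (fun (t : Fin n) (k : K) => (w k * x k (σ t)) • y k)
    rw [e]
    refine this.trans (Finset.sum_congr rfl fun f _ => ?_)
    exact (Matrix.detRowAlternating (R := ℂ) (n := Fin n)).toMultilinearMap.map_smul_univ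
      (fun t => w (f t) * x (f t) (σ t)) (fun t => y (f t))
  have h2 : ∀ σ : Equiv.Perm (Fin n), M.det
      = ((Equiv.Perm.sign σ : ℤ) : ℂ) * (M.submatrix σ id).det := by
    intro σ
    rw [Matrix.det_permute, ← mul_assoc, ← Int.cast_mul]
    simp
  have h3 : (n.factorial : ℂ) * M.det = ∑ _σ : Equiv.Perm (Fin n), M.det := by
    simp [Fintype.card_perm]
  rw [h3, Finset.sum_congr rfl fun σ _ => (h2 σ).trans (by rw [h1 σ])]
  simp_rw [Finset.mul_sum]
  rw [Finset.sum_comm]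
  refine Finset.sum_congr rfl fun f _ => ?_
  rw [← Matrix.det_transpose (Matrix.of fun t r => x (f t) r), Matrix.det_apply' (Matrix.of fun t r => x (f t) r)ᵀ,
    Finset.sum_mul, Finset.mul_sum]
  refine Finset.sum_congr rfl fun σ _ => ?_
  simp only [Finset.prod_mul_distrib, Matrix.transpose_apply, Matrix.of_apply]
  ring

lemma coef_nonneg {n : ℕ} (a : Fin n → Fin 3) :
    0 ≤ 1 + (∏ t, if a t = 0 then (1 : ℝ) else 0) + (∏ t, if a t = 1 then (1 : ℝ) else 0)
      + (∏ t, if a t = 2 then (1 : ℝ) else 0) - (∏ t, if a t ≠ 2 then (1 : ℝ) else 0)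
      - (∏ t, if a t ≠ 1 then (1 : ℝ) else 0) - (∏ t, if a t ≠ 0 then (1 : ℝ) else 0) := by
  simp only [Finset.prod_ite_zero, Finset.prod_const_one, Finset.mem_univ, true_imp_iff]
  have k0 : (∀ t, a t ≠ 2) → (∀ t, a t ≠ 1) → ∀ t, a t = 0 := fun h h' t => by
    have := h t; have := h' t; omega
  have k1 : (∀ t, a t ≠ 2) → (∀ t, a t ≠ 0) → ∀ t, a t = 1 := fun h h' t => by
    have := h t; have := h' t; omega
  have k2 : (∀ t, a t ≠ 1) → (∀ t, a t ≠ 0) → ∀ t, a t = 2 := fun h h' t => by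
    have := h t; have := h' t; omega
  split_ifs <;> first | (norm_num; done) | (exfalso; tauto)

theorem det2_superadditive_three {m n : ℕ}
    (A B C : Matrix (Fin m × Fin n) (Fin m × Fin n) ℂ)
    (hA : A.PosSemidef) (hB : B.PosSemidef) (hC : C.PosSemidef) :
    (det2 (A + B + C) + det2 A + det2 B + det2 C
      - det2 (A + B) - det2 (A + C) - det2 (B + C)).PosSemidef := by
  obtain ⟨X, rfl⟩ := psd_factor hA
  obtain ⟨Y, rfl⟩ := psd_factor hB
  obtain ⟨Z, rfl⟩ := psd_factor hC
  let V : Fin 3 × (Fin m × Fin n) → Fin m → Fin n → ℂ :=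
    fun k i r => (![X, Y, Z] k.1) k.2 (i, r)
  let g : (Fin n → Fin 3 × (Fin m × Fin n)) → Fin m → ℂ :=
    fun f i => (Matrix.of fun t r => V (f t) i r).det
  have key : ∀ (w : Fin 3 → ℝ) (D : Matrix (Fin m × Fin n) (Fin m × Fin n) ℂ),
      D = (w 0 : ℂ) • (Xᴴ * X) + (w 1 : ℂ) • (Yᴴ * Y) + (w 2 : ℂ) • (Zᴴ * Z) →
      ∀ i j, det2 D i j = (n.factorial : ℂ)⁻¹ * ∑ f : Fin n → Fin 3 × (Fin m × Fin n),
        ((∏ t, w (f t).1 : ℝ) : ℂ) * (star (g f i) * g f j) := by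
    intro w D hD i j
    rw [eq_inv_mul_iff_mul_eq₀ (by exact_mod_cast n.factorial_ne_zero)]
    have := cb_det (fun k : Fin 3 × (Fin m × Fin n) => (w k.1 : ℂ))
      (fun k r => star (V k i r)) (fun k => V k j)
    have e : (Matrix.of fun r s => D (i, r) (j, s)) = Matrix.of fun r s =>
        ∑ k : Fin 3 × (Fin m × Fin n), (w k.1 : ℂ) * (star (V k i r) * V k j s) := by
      ext r s
      rw [hD]
      simp only [Matrix.of_apply, Fintype.sum_prod_type (α₁ := Fin 3), Fin.sum_univ_three,
        Matrix.add_apply, Matrix.smul_apply, Matrix.mul_apply, Finset.mul_sum, smul_eq_mul,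
        Matrix.conjTranspose_apply, V]
      rfl
    simp only [det2, Matrix.of_apply]
    rw [e, this]
    refine Finset.sum_congr rfl fun f _ => ?_
    push_cast
    simp only [g]
    rw [← Matrix.det_conjTranspose, ← Matrix.det_transpose]
    rfl
  let c : (Fin n → Fin 3 × (Fin m × Fin n)) → ℝ := fun f =>
    1 + (∏ t, if (f t).1 = 0 then (1 : ℝ) else 0) + (∏ t, if (f t).1 = 1 then (1 : ℝ) else 0)
      + (∏ t, if (f t).1 = 2 then (1 : ℝ) else 0) - (∏ t, if (f t).1 ≠ 2 then (1 : ℝ) else 0)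
      - (∏ t, if (f t).1 ≠ 1 then (1 : ℝ) else 0) - (∏ t, if (f t).1 ≠ 0 then (1 : ℝ) else 0)
  have main : (det2 (Xᴴ * X + Yᴴ * Y + Zᴴ * Z) + det2 (Xᴴ * X) + det2 (Yᴴ * Y) + det2 (Zᴴ * Z)
      - det2 (Xᴴ * X + Yᴴ * Y) - det2 (Xᴴ * X + Zᴴ * Z) - det2 (Yᴴ * Y + Zᴴ * Z))
      = ∑ f, ((n.factorial : ℝ)⁻¹ * c f) • Matrix.vecMulVec (star (g f)) (g f) := by
    ext i j
    simp only [Matrix.sub_apply, Matrix.add_apply]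
    rw [key (fun _ => 1) (Xᴴ * X + Yᴴ * Y + Zᴴ * Z) (by simp),
      key (fun k => if k = 0 then 1 else 0) (Xᴴ * X) (by simp),
      key (fun k => if k = 1 then 1 else 0) (Yᴴ * Y) (by simp),
      key (fun k => if k = 2 then 1 else 0) (Zᴴ * Z) (by simp),
      key (fun k => if k ≠ 2 then 1 else 0) (Xᴴ * X + Yᴴ * Y) (by simp),
      key (fun k => if k ≠ 1 then 1 else 0) (Xᴴ * X + Zᴴ * Z) (by simp),
      key (fun k => if k ≠ 0 then 1 else 0) (Yᴴ * Y + Zᴴ * Z) (by simp)]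
    simp only [← mul_add, ← mul_sub, ← Finset.sum_add_distrib, ← Finset.sum_sub_distrib]
    rw [Matrix.sum_apply, Finset.mul_sum]
    refine Finset.sum_congr rfl fun f _ => ?_
    rw [Matrix.smul_apply, Matrix.vecMulVec_apply, Complex.real_smul]
    simp only [c, Pi.star_apply, Finset.prod_const_one]
    push_cast
    ring
  rw [main]
  refine Matrix.posSemidef_sum _ fun f _ => ?_
  have hc : 0 ≤ (n.factorial : ℝ)⁻¹ * c f :=
    mul_nonneg (by positivity) (coef_nonneg fun t => (f t).1)
  exact (Matrix.posSemidef_vecMulVec_star_self (g f)).smul hc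
end

section
/- Let A = [A_ij], B = [B_ij], C = [C_ij] ∈ M_m(M_n) be positive semidefinite block matrices and let r be a positive integer. For a block matrix X, let (p_r)₂(X) denote the m×m matrix [(tr X_ij)^r]_{i,j=1}^m. Then (p_r)₂(A+B+C) + (p_r)₂(A) + (p_r)₂(B) + (p_r)₂(C) ≥ (p_r)₂(A+B) + (p_r)₂(A+C) + (p_r)₂(B+C) in the Löwner order, i.e., the difference is positive semidefinite. -/
open Matrix BigOperators
open scoped ComplexOrder

/-- The second partial matrix function associated with `p_r(X) = (tr X)^r`:
the `m × m` matrix `[(tr A_ij)^r]`. -/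
noncomputable def pr2 {m n : ℕ} (r : ℕ) (A : Matrix (Fin m × Fin n) (Fin m × Fin n) ℂ) :
    Matrix (Fin m) (Fin m) ℂ :=
  Matrix.of fun i j => ((Matrix.of fun p q => A (i, p) (j, q)).trace) ^ r

/-- Positive semidefinite kernels. -/
def KPos {m : ℕ} (f : Fin m → Fin m → ℂ) : Prop := (Matrix.of f).PosSemidef

theorem KPos.add {m : ℕ} {f g : Fin m → Fin m → ℂ} (hf : KPos f) (hg : KPos g) :
    KPos (f + g) := Matrix.PosSemidef.add hf hg

theorem KPos.mul {m : ℕ} {f g : Fin m → Fin m → ℂ} (hf : KPos f) (hg : KPos g) :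
    KPos (f * g) := Matrix.PosSemidef.hadamard hf hg

theorem KPos.zero {m : ℕ} : KPos (0 : Fin m → Fin m → ℂ) := Matrix.PosSemidef.zero

theorem KPos.one {m : ℕ} : KPos (1 : Fin m → Fin m → ℂ) := by
  have h := Matrix.posSemidef_vecMulVec_self_star (fun _ : Fin m => (1 : ℂ))
  have e : (Matrix.of (1 : Fin m → Fin m → ℂ)) =
      Matrix.vecMulVec (fun _ : Fin m => (1 : ℂ)) (star (fun _ : Fin m => (1 : ℂ))) := by
    ext i j
    simp [Matrix.vecMulVec_apply]
  unfold KPos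
  rw [e]
  exact h

theorem KPos.pow {m : ℕ} {f : Fin m → Fin m → ℂ} (hf : KPos f) (k : ℕ) : KPos (f ^ k) := by
  induction k with
  | zero => rw [pow_zero]; exact KPos.one
  | succ k ih => rw [pow_succ]; exact ih.mul hf

theorem KPos.d1 {m : ℕ} {x y : Fin m → Fin m → ℂ} (hx : KPos x) (hy : KPos y) (k : ℕ) :
    KPos ((x + y) ^ k - x ^ k) := by
  induction k with
  | zero => simpa using KPos.zero
  | succ k ih =>
    have e : (x + y) ^ (k + 1) - x ^ (k + 1) = x * ((x + y) ^ k - x ^ k) + y * (x + y) ^ k := by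
      ring
    rw [e]
    exact (hx.mul ih).add (hy.mul ((hx.add hy).pow k))

theorem KPos.d2 {m : ℕ} {a b c : Fin m → Fin m → ℂ} (ha : KPos a) (hb : KPos b) (hc : KPos c)
    (k : ℕ) : KPos ((a + b + c) ^ k - (a + b) ^ k - (a + c) ^ k + a ^ k) := by
  induction k with
  | zero => simpa using KPos.zero
  | succ k ih =>
    have e : (a + b + c) ^ (k + 1) - (a + b) ^ (k + 1) - (a + c) ^ (k + 1) + a ^ (k + 1) =
        a * ((a + b + c) ^ k - (a + b) ^ k - (a + c) ^ k + a ^ k)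
        + b * ((a + b + c) ^ k - (a + b) ^ k) + c * ((a + c + b) ^ k - (a + c) ^ k) := by
      rw [add_right_comm a c b]
      ring
    rw [e]
    exact ((ha.mul ih).add (hb.mul ((ha.add hb).d1 hc k))).add (hc.mul ((ha.add hc).d1 hb k))

theorem KPos.d3 {m : ℕ} {a b c : Fin m → Fin m → ℂ} (ha : KPos a) (hb : KPos b) (hc : KPos c)
    (k : ℕ) : KPos ((a + b + c) ^ (k + 1) + a ^ (k + 1) + b ^ (k + 1) + c ^ (k + 1)
      - (a + b) ^ (k + 1) - (a + c) ^ (k + 1) - (b + c) ^ (k + 1)) := by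
  have e : (a + b + c) ^ (k + 1) + a ^ (k + 1) + b ^ (k + 1) + c ^ (k + 1)
      - (a + b) ^ (k + 1) - (a + c) ^ (k + 1) - (b + c) ^ (k + 1) =
      a * ((a + b + c) ^ k - (a + b) ^ k - (a + c) ^ k + a ^ k)
      + b * ((b + a + c) ^ k - (b + a) ^ k - (b + c) ^ k + b ^ k)
      + c * ((c + a + b) ^ k - (c + a) ^ k - (c + b) ^ k + c ^ k) := by
    rw [show b + a + c = a + b + c by ring, show c + a + b = a + b + c by ring,
      add_comm b a, add_comm c a, add_comm c b]
    ring
  rw [e]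
  exact ((ha.mul (ha.d2 hb hc k)).add (hb.mul (hb.d2 ha hc k))).add (hc.mul (hc.d2 ha hb k))

theorem KPos.ptrace {m n : ℕ} {A : Matrix (Fin m × Fin n) (Fin m × Fin n) ℂ}
    (hA : A.PosSemidef) : KPos (fun i j => ∑ p, A (i, p) (j, p)) := by
  have e : Matrix.of (fun i j => ∑ p, A (i, p) (j, p)) =
      ∑ p, A.submatrix (fun i => (i, p)) (fun i => (i, p)) := by
    ext i j
    simp [Matrix.sum_apply]
  unfold KPos
  rw [e]
  exact Matrix.posSemidef_sum _ fun p _ => hA.submatrix _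

theorem pr2_superadditive_three {m n : ℕ}
    (A B C : Matrix (Fin m × Fin n) (Fin m × Fin n) ℂ)
    (hA : A.PosSemidef) (hB : B.PosSemidef) (hC : C.PosSemidef) (r : ℕ) (hr : 0 < r) :
    (pr2 r (A + B + C) + pr2 r A + pr2 r B + pr2 r C
      - pr2 r (A + B) - pr2 r (A + C) - pr2 r (B + C)).PosSemidef := by
  obtain ⟨k, rfl⟩ : ∃ k, r = k + 1 := ⟨r - 1, by omega⟩
  have h := KPos.d3 (KPos.ptrace hA) (KPos.ptrace hB) (KPos.ptrace hC) k
  unfold KPos at h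
  convert h using 1
  ext i j
  simp [pr2, Matrix.trace, Finset.sum_add_distrib]
end

section
/- Let A = [A_ij], B = [B_ij], C = [C_ij] ∈ M_m(M_n) be positive semidefinite block matrices and let r be a positive integer with r ≤ n. For a block matrix X, let (e_r)₂(X) denote the m×m matrix [e_r(X_ij)]_{i,j=1}^m, where e_r(Y) is the sum of all r×r principal minors of the n×n matrix Y. Then (e_r)₂(A+B+C) + (e_r)₂(A) + (e_r)₂(B) + (e_r)₂(C) ≥ (e_r)₂(A+B) + (e_r)₂(A+C) + (e_r)₂(B+C) in the Löwner order, i.e., the difference is positive semidefinite. -/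
open Matrix BigOperators
open scoped ComplexOrder

/-- `e_r(Y)`: the sum of all `r × r` principal minors of the `n × n` matrix `Y`,
which equals the `r`-th elementary symmetric function of the eigenvalues of `Y`. -/
noncomputable def esymmMinors {n : ℕ} (r : ℕ) (Y : Matrix (Fin n) (Fin n) ℂ) : ℂ :=
  ∑ S ∈ Finset.univ.powersetCard r,
    (Y.submatrix (fun a : {x : Fin n // x ∈ S} => (a : Fin n))
      (fun a : {x : Fin n // x ∈ S} => (a : Fin n))).det

/-- The second partial matrix function associated with `e_r`:
the `m × m` matrix `[e_r (A_ij)]`. -/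
noncomputable def er2 {m n : ℕ} (r : ℕ) (A : Matrix (Fin m × Fin n) (Fin m × Fin n) ℂ) :
    Matrix (Fin m) (Fin m) ℂ :=
  Matrix.of fun i j => esymmMinors r (Matrix.of fun p q => A (i, p) (j, q))

theorem aux_prod {R ι : Type*} [CommRing R] [DecidableEq ι] (P : Subsemiring R) (a b c : ι → R)
    (ha : ∀ i, a i ∈ P) (hb : ∀ i, b i ∈ P) (hc : ∀ i, c i ∈ P) (s : Finset ι) :
    ∏ i ∈ s, (a i + b i) ∈ P ∧
    ∏ i ∈ s, (a i + b i + c i) ∈ P ∧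
    ∏ i ∈ s, (a i + b i + c i) - ∏ i ∈ s, (a i + b i) ∈ P := by
  have h1 : ∏ i ∈ s, (a i + b i + c i) ∈ P :=
    prod_mem fun i _ => add_mem (add_mem (ha i) (hb i)) (hc i)
  refine ⟨prod_mem fun i _ => add_mem (ha i) (hb i), h1, ?_⟩
  clear h1
  induction s using Finset.induction_on with
  | empty => simp
  | insert x s hx ih =>
    have h1 : ∏ i ∈ s, (a i + b i + c i) ∈ P :=
      prod_mem fun i _ => add_mem (add_mem (ha i) (hb i)) (hc i)
    rw [Finset.prod_insert hx, Finset.prod_insert hx]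
    have := add_mem (mul_mem (add_mem (ha x) (hb x)) ih) (mul_mem (hc x) h1)
    convert this using 1
    ring

theorem aux_prod2 {R ι : Type*} [CommRing R] [DecidableEq ι] (P : Subsemiring R) (a b c : ι → R)
    (ha : ∀ i, a i ∈ P) (hb : ∀ i, b i ∈ P) (hc : ∀ i, c i ∈ P) (s : Finset ι) :
    ∏ i ∈ s, (a i + b i + c i) + ∏ i ∈ s, a i
      - ∏ i ∈ s, (a i + b i) - ∏ i ∈ s, (a i + c i) ∈ P := by
  induction s using Finset.induction_on with
  | empty => simp
  | insert x s hx ih =>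
    have h1 := (aux_prod P a b c ha hb hc s).2.2
    have h2 := (aux_prod P a c b ha hc hb s).2.2
    simp only [add_right_comm _ (c _) (b _)] at h2
    simp only [Finset.prod_insert hx]
    have := add_mem (add_mem (mul_mem (ha x) ih) (mul_mem (hb x) h1)) (mul_mem (hc x) h2)
    convert this using 1
    ring

theorem aux_prod3 {R ι : Type*} [CommRing R] [DecidableEq ι] (P : Subsemiring R) (a b c : ι → R)
    (ha : ∀ i, a i ∈ P) (hb : ∀ i, b i ∈ P) (hc : ∀ i, c i ∈ P) (s : Finset ι) :
    ∏ i ∈ s, (a i + b i + c i) + ∏ i ∈ s, a i + ∏ i ∈ s, b i + ∏ i ∈ s, c i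
      - ∏ i ∈ s, (a i + b i) - ∏ i ∈ s, (a i + c i) - ∏ i ∈ s, (b i + c i) ∈ P := by
  induction s using Finset.induction_on with
  | empty => simp [one_mem]
  | insert x s hx ih =>
    have h1 := aux_prod2 P a b c ha hb hc s
    have h2 := aux_prod2 P b a c hb ha hc s
    have h3 := aux_prod2 P c a b hc ha hb s
    have e1 : ∀ i, b i + a i = a i + b i := fun i => add_comm _ _
    have e2 : ∀ i, c i + a i = a i + c i := fun i => add_comm _ _
    have e3 : ∀ i, c i + b i = b i + c i := fun i => add_comm _ _
    have e4 : ∀ i, a i + c i + b i = a i + b i + c i := fun i => by ring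
    simp only [e1] at h2
    simp only [e2, e3, e4] at h3
    simp only [Finset.prod_insert hx]
    have := add_mem (add_mem (mul_mem (ha x) h1) (mul_mem (hb x) h2)) (mul_mem (hc x) h3)
    convert this using 1
    ring

/-- PSD matrices form a subsemiring under the Hadamard product. -/
def psdSemiring (N : Type*) [Fintype N] : Subsemiring (N → N → ℂ) where
  carrier := {f | (Matrix.of f).PosSemidef}
  mul_mem' {a b} ha hb := by
    exact Matrix.PosSemidef.hadamard ha hb
  one_mem' := by
    change (Matrix.of (1 : N → N → ℂ)).PosSemidef
    have := Matrix.posSemidef_vecMulVec_self_star (fun _ : N => (1 : ℂ))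
    convert this using 1
    ext i j
    simp [Matrix.vecMulVec]
  add_mem' {a b} ha hb := Matrix.PosSemidef.add ha hb
  zero_mem' := Matrix.PosSemidef.zero

theorem fact_det {k : Type*} [Fintype k] [DecidableEq k] (Y : Matrix k k ℂ) :
    ∑ σ : Equiv.Perm k, ∑ τ : Equiv.Perm k,
      ((Equiv.Perm.sign σ : ℤ) : ℂ) * (∏ a, Y (σ a) (τ a)) * ((Equiv.Perm.sign τ : ℤ) : ℂ)
      = (Fintype.card (Equiv.Perm k) : ℂ) * Y.det := by
  rw [Finset.sum_comm]
  have : ∀ τ : Equiv.Perm k, ∑ σ : Equiv.Perm k,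
      ((Equiv.Perm.sign σ : ℤ) : ℂ) * (∏ a, Y (σ a) (τ a)) * ((Equiv.Perm.sign τ : ℤ) : ℂ)
      = Y.det := by
    intro τ
    rw [← Finset.sum_mul]
    have h := Matrix.det_permute' τ Y
    rw [Matrix.det_apply'] at h
    simp only [Matrix.submatrix_apply, id] at h
    rw [h, mul_right_comm]
    norm_cast
    simp
  simp [this]

/-- signed collapse matrix -/
def collapse (m : ℕ) (k : Type*) [Fintype k] [DecidableEq k] :
    Matrix (Fin m × Equiv.Perm k) (Fin m) ℂ :=
  Matrix.of fun p j => if p.1 = j then ((Equiv.Perm.sign p.2 : ℤ) : ℂ) else 0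

theorem collapse_entry {m : ℕ} {k : Type*} [Fintype k] [DecidableEq k]
    (D : Matrix (Fin m × Equiv.Perm k) (Fin m × Equiv.Perm k) ℂ) (i j : Fin m) :
    ((collapse m k)ᴴ * D * collapse m k) i j =
      ∑ σ : Equiv.Perm k, ∑ τ : Equiv.Perm k,
      ((Equiv.Perm.sign σ : ℤ) : ℂ) * D (i, σ) (j, τ) * ((Equiv.Perm.sign τ : ℤ) : ℂ) := by
  rw [Finset.sum_comm]
  simp [Matrix.mul_apply, collapse, Fintype.sum_prod_type, apply_ite, ite_mul, mul_ite,
    Finset.sum_mul]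

/-- block determinants -/
def detBlk {m : ℕ} {n k : Type*} [Fintype k] [DecidableEq k] (f : k → n)
    (A : Matrix (Fin m × n) (Fin m × n) ℂ) : Matrix (Fin m) (Fin m) ℂ :=
  Matrix.of fun i j => (Matrix.of fun p q => A (i, f p) (j, f q)).det

/-- blown up product -/
def had {m : ℕ} {n k : Type*} (f : k → n)
    (A : Matrix (Fin m × n) (Fin m × n) ℂ) (a : k) :
    (Fin m × Equiv.Perm k) → (Fin m × Equiv.Perm k) → ℂ :=
  fun p q => A (p.1, f (p.2 a)) (q.1, f (q.2 a))

theorem had_mem {m : ℕ} {n k : Type*} [Fintype k] [DecidableEq k] (f : k → n)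
    (A : Matrix (Fin m × n) (Fin m × n) ℂ) (hA : A.PosSemidef) (a : k) :
    had f A a ∈ psdSemiring (Fin m × Equiv.Perm k) :=
  hA.submatrix fun p : Fin m × Equiv.Perm k => (p.1, f (p.2 a))

theorem detBlk_eq {m : ℕ} {n k : Type*} [Fintype k] [DecidableEq k] (f : k → n)
    (A : Matrix (Fin m × n) (Fin m × n) ℂ) :
    (collapse m k)ᴴ * Matrix.of (∏ a, had f A a) * collapse m k
      = (Fintype.card (Equiv.Perm k) : ℂ) • detBlk f A := by
  ext i j
  rw [collapse_entry]
  have := fact_det (Matrix.of fun p q : k => A (i, f p) (j, f q))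
  simpa [detBlk, had, Finset.prod_apply] using this

theorem detBlk_psd {m : ℕ} {n k : Type*} [Fintype k] [DecidableEq k] (f : k → n)
    (A B C : Matrix (Fin m × n) (Fin m × n) ℂ)
    (hA : A.PosSemidef) (hB : B.PosSemidef) (hC : C.PosSemidef) :
    (detBlk f (A + B + C) + detBlk f A + detBlk f B + detBlk f C
      - detBlk f (A + B) - detBlk f (A + C) - detBlk f (B + C)).PosSemidef := by
  have h : (Matrix.of _).PosSemidef := aux_prod3 (psdSemiring (Fin m × Equiv.Perm k))
    (had f A) (had f B) (had f C) (had_mem f A hA) (had_mem f B hB) (had_mem f C hC) Finset.univ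
  have h2 := h.conjTranspose_mul_mul_same (collapse m k)
  have hadd : ∀ X Y : Matrix (Fin m × n) (Fin m × n) ℂ, ∀ a,
    had f X a + had f Y a = had f (X + Y) a := fun _ _ _ => rfl
  simp only [hadd, ← Matrix.of_add_of, ← Matrix.of_sub_of, Matrix.mul_add, Matrix.mul_sub,
    Matrix.add_mul, Matrix.sub_mul, detBlk_eq] at h2
  simp only [← smul_add, ← smul_sub] at h2
  have hc : (0 : ℂ) ≤ ((Fintype.card (Equiv.Perm k) : ℂ))⁻¹ := by
    rw [inv_nonneg]
    exact_mod_cast Nat.zero_le _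
  have h3 := h2.smul hc
  rwa [inv_smul_smul₀ (by exact_mod_cast Fintype.card_ne_zero)] at h3

theorem er2_eq {m n : ℕ} (r : ℕ) (A : Matrix (Fin m × Fin n) (Fin m × Fin n) ℂ) :
    er2 r A = ∑ S ∈ (Finset.univ : Finset (Fin n)).powersetCard r,
      detBlk (fun a : {x : Fin n // x ∈ S} => (a : Fin n)) A := by
  ext i j
  rw [Matrix.sum_apply]
  rfl

theorem er2_superadditive_three {m n : ℕ}
    (A B C : Matrix (Fin m × Fin n) (Fin m × Fin n) ℂ)
    (hA : A.PosSemidef) (hB : B.PosSemidef) (hC : C.PosSemidef)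
    (r : ℕ) (hr : 0 < r) (hrn : r ≤ n) :
    (er2 r (A + B + C) + er2 r A + er2 r B + er2 r C
      - er2 r (A + B) - er2 r (A + C) - er2 r (B + C)).PosSemidef := by
  simp only [er2_eq, ← Finset.sum_add_distrib, ← Finset.sum_sub_distrib]
  exact Matrix.posSemidef_sum _ fun S _ => detBlk_psd _ A B C hA hB hC
end

section
/- Let A = [A_ij], B = [B_ij], C = [C_ij] ∈ M_m(M_n) be positive semidefinite block matrices. Then det₂(A+B+C) + det₂(C) ≥ det₂(A+C) + det₂(B+C) in the Löwner order, i.e., the m×m matrix det₂(A+B+C) + det₂(C) − det₂(A+C) − det₂(B+C) is positive semidefinite. -/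
open Matrix BigOperators
open scoped ComplexOrder

theorem hadC {I : Type*} {A B : Matrix I I ℂ}
    (hA : A.PosSemidef) (hB : B.PosSemidef) : (A ⊙ B).PosSemidef :=
  Matrix.PosSemidef.hadamard (𝕜 := ℂ) hA hB

theorem prodStep {I K : Type*} [Fintype I] [DecidableEq I]
    (a b c : K → Matrix I I ℂ) (ha : ∀ k, (a k).PosSemidef) (hb : ∀ k, (b k).PosSemidef)
    (hc : ∀ k, (c k).PosSemidef) (s : Finset K) :
    (Matrix.of fun p q => ∏ k ∈ s, (a k p q + b k p q + c k p q)).PosSemidef ∧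
    (Matrix.of fun p q => ∏ k ∈ s, (a k p q + b k p q + c k p q)
      - ∏ k ∈ s, (a k p q + c k p q)).PosSemidef ∧
    (Matrix.of fun p q => ∏ k ∈ s, (a k p q + b k p q + c k p q)
      - ∏ k ∈ s, (b k p q + c k p q)).PosSemidef ∧
    (Matrix.of fun p q => ∏ k ∈ s, (a k p q + b k p q + c k p q) + ∏ k ∈ s, c k p q
      - ∏ k ∈ s, (a k p q + c k p q) - ∏ k ∈ s, (b k p q + c k p q)).PosSemidef := by
  classical
  induction s using Finset.induction_on with
  | empty =>
    have h0 : (Matrix.of fun _ _ => (0 : ℂ) : Matrix I I ℂ).PosSemidef := Matrix.PosSemidef.zero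
    refine ⟨?_, ?_, ?_, ?_⟩
    · simpa [Matrix.vecMulVec] using
        Matrix.posSemidef_vecMulVec_self_star (R := ℂ) (fun _ : I => (1 : ℂ))
    · simpa using h0
    · simpa using h0
    · simpa using h0
  | insert k s hk ih =>
    obtain ⟨h1, h2, h3, h4⟩ := ih
    refine ⟨?_, ?_, ?_, ?_⟩
    · convert hadC (((ha k).add (hb k)).add (hc k)) h1 using 1
      ext p q
      simp [Finset.prod_insert hk]
    · convert (hadC ((ha k).add (hc k)) h2).add (hadC (hb k) h1) using 1
      ext p q
      simp [Finset.prod_insert hk]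
      ring
    · convert (hadC ((hb k).add (hc k)) h3).add (hadC (ha k) h1) using 1
      ext p q
      simp [Finset.prod_insert hk]
      ring
    · convert ((hadC (hc k) h4).add (hadC (ha k) h2)).add (hadC (hb k) h3) using 1
      ext p q
      simp [Finset.prod_insert hk]
      ring

theorem sum_sum_det {n : ℕ} (M : Matrix (Fin n) (Fin n) ℂ) :
    ∑ σ : Equiv.Perm (Fin n), ∑ τ : Equiv.Perm (Fin n),
      ((Equiv.Perm.sign σ : ℤ) : ℂ) * ((Equiv.Perm.sign τ : ℤ) : ℂ) * ∏ k, M (σ k) (τ k)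
      = (n.factorial : ℂ) * M.det := by
  have h : ∀ σ : Equiv.Perm (Fin n), ∑ τ : Equiv.Perm (Fin n),
      ((Equiv.Perm.sign σ : ℤ) : ℂ) * ((Equiv.Perm.sign τ : ℤ) : ℂ) * ∏ k, M (σ k) (τ k)
      = M.det := by
    intro σ
    have h1 := Matrix.det_permute σ M
    rw [← Matrix.det_transpose, Matrix.det_apply'] at h1
    simp only [Matrix.transpose_apply, Matrix.submatrix_apply, id] at h1
    simp only [mul_assoc]
    rw [← Finset.mul_sum, h1, ← mul_assoc, ← Int.cast_mul, ← Units.val_mul,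
      Int.units_mul_self]
    simp
  simp [h, Fintype.card_perm]

theorem compress {m : ℕ} {P : Type*} [Fintype P] [DecidableEq P] (w : P → ℤ)
    (M : Matrix (Fin m × P) (Fin m × P) ℂ) (hM : M.PosSemidef) :
    (Matrix.of fun i j => ∑ σ, ∑ τ, (w σ : ℂ) * (w τ : ℂ) * M (i, σ) (j, τ)).PosSemidef := by
  have h := hM.conjTranspose_mul_mul_same
    (Matrix.of fun (p : Fin m × P) (j : Fin m) => if p.1 = j then (w p.2 : ℂ) else 0)
  convert h using 1
  ext i j
  simp only [Matrix.mul_apply, Matrix.conjTranspose_apply, Matrix.of_apply,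
    Fintype.sum_prod_type, apply_ite star, star_zero, ite_mul, mul_ite, zero_mul, mul_zero]
  rw [Finset.sum_eq_single j]
  · simp only [if_true]
    rw [Finset.sum_comm]
    refine Finset.sum_congr rfl fun τ _ => ?_
    rw [Finset.sum_mul]
    rw [Finset.sum_eq_single i]
    · simp [Finset.sum_mul]
      refine Finset.sum_congr rfl fun σ _ => ?_
      ring
    · intro b _ hb
      simp [hb]
    · simp
  · intro b _ hb
    simp [hb]
  · simp

theorem det2_three_term {m n : ℕ}
    (A B C : Matrix (Fin m × Fin n) (Fin m × Fin n) ℂ)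
    (hA : A.PosSemidef) (hB : B.PosSemidef) (hC : C.PosSemidef) :
    (det2 (A + B + C) + det2 C - det2 (A + C) - det2 (B + C)).PosSemidef := by
  let e : Fin n → (Fin m × Equiv.Perm (Fin n)) → Fin m × Fin n := fun k p => (p.1, p.2 k)
  have h := (prodStep (fun k => A.submatrix (e k) (e k)) (fun k => B.submatrix (e k) (e k))
    (fun k => C.submatrix (e k) (e k)) (fun k => hA.submatrix _) (fun k => hB.submatrix _)
    (fun k => hC.submatrix _) Finset.univ).2.2.2
  have h' := compress (fun σ : Equiv.Perm (Fin n) => (Equiv.Perm.sign σ : ℤ)) _ h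
  have hn : (0 : ℂ) ≤ ((n.factorial : ℂ))⁻¹ := by
    rw [inv_nonneg]
    exact Nat.cast_nonneg _
  convert h'.smul hn using 1
  have hne : (n.factorial : ℂ) ≠ 0 := by exact_mod_cast n.factorial_ne_zero
  ext i j
  rw [Matrix.smul_apply, smul_eq_mul, eq_inv_mul_iff_mul_eq₀ hne]
  simp only [det2, Matrix.sub_apply, Matrix.add_apply, Matrix.of_apply, mul_sub, mul_add,
    ← sum_sum_det, Matrix.submatrix_apply, e, Finset.sum_sub_distrib, Finset.sum_add_distrib]
end

section
/- Let A, B, C be n×n positive semidefinite complex matrices. Then det(A+B+C) + det(A) + det(B) + det(C) ≥ det(A+B) + det(A+C) + det(B+C). -/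
open Matrix
open scoped ComplexOrder

/-- A weighted Cauchy-Binet formula, summed over all functions. -/
theorem cauchy_binet_fun {n : ℕ} {κ : Type} [Fintype κ] (d : κ → ℂ) (v : κ → Fin n → ℂ)
    (M : Matrix (Fin n) (Fin n) ℂ) (hM : ∀ i j, M i j = ∑ k, d k * (v k i * star (v k j))) :
    (n.factorial : ℂ) * M.det = ∑ f : Fin n → κ, (∏ i, d (f i)) *
      (Matrix.det (fun i j => v (f i) j) * star (Matrix.det (fun i j => v (f i) j))) := by
  classical
  have h1 : M.det = ∑ f : Fin n → κ, (∏ i, d (f i)) * (∏ i, v (f i) i) *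
      star (Matrix.det (fun i j => v (f i) j)) := by
    have hM' : M = fun i => ∑ k, (d k * v k i) • (star (v k)) := by
      funext i j
      rw [hM, Finset.sum_apply]
      refine Finset.sum_congr rfl fun k _ => ?_
      simp only [Pi.smul_apply, Pi.star_apply, smul_eq_mul, mul_assoc]
    have h2 : M.det = Matrix.detRowAlternating (R := ℂ) (n := Fin n)
        (fun i => ∑ k, (d k * v k i) • (star (v k))) := by
      rw [← hM']; rfl
    rw [h2, ← AlternatingMap.coe_multilinearMap, MultilinearMap.map_sum]
    refine Finset.sum_congr rfl fun f _ => ?_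
    rw [MultilinearMap.map_smul_univ, Finset.prod_mul_distrib, smul_eq_mul]
    congr 1
    have h3 := Matrix.det_conjTranspose (M := (fun i j => v (f i) j : Matrix (Fin n) (Fin n) ℂ))
    rw [← h3, ← Matrix.det_transpose]
    rfl
  have h4 : (n.factorial : ℂ) * M.det = ∑ σ : Equiv.Perm (Fin n), M.det := by
    simp only [Finset.sum_const, Finset.card_univ, Fintype.card_perm, Fintype.card_fin, nsmul_eq_mul]
  rw [h4]
  have h5 : ∀ σ : Equiv.Perm (Fin n), M.det = ∑ f : Fin n → κ, (∏ i, d (f i)) *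
      (((Equiv.Perm.sign σ : ℤ) : ℂ) * (∏ i, v (f (σ i)) i)) *
      star (Matrix.det (fun i j => v (f i) j)) := by
    intro σ
    rw [h1, ← (Equiv.arrowCongr σ.symm (Equiv.refl κ)).sum_comp]
    refine Finset.sum_congr rfl fun f _ => ?_
    have h6 := Matrix.det_permute σ (fun i j => v (f i) j : Matrix (Fin n) (Fin n) ℂ)
    have h7 : Matrix.det (fun i j => v (f (σ i)) j) =
      ((Equiv.Perm.sign σ : ℤ) : ℂ) * Matrix.det (fun i j => v (f i) j) := h6
    have h8 := Equiv.prod_comp σ (fun i => d (f i))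
    simp only [Equiv.arrowCongr_apply, Equiv.symm_symm, Function.comp_apply,
      Equiv.coe_refl, id]
    rw [h7, h8]
    simp only [star_mul', star_intCast]
    ring
  rw [Finset.sum_congr rfl fun σ _ => h5 σ, Finset.sum_comm]
  refine Finset.sum_congr rfl fun f _ => ?_
  rw [← Finset.sum_mul, ← Finset.mul_sum, mul_assoc]
  congr 2
  exact (Matrix.det_apply' (fun i j => v (f i) j : Matrix (Fin n) (Fin n) ℂ)).symm

theorem weight_ineq {n : ℕ} (g : Fin n → Fin 3) :
    (∏ i, (![1, 1, 0] : Fin 3 → ℝ) (g i)) + (∏ i, (![1, 0, 1] : Fin 3 → ℝ) (g i)) +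
      (∏ i, (![0, 1, 1] : Fin 3 → ℝ) (g i)) ≤
    (∏ i, (![1, 1, 1] : Fin 3 → ℝ) (g i)) + (∏ i, (![1, 0, 0] : Fin 3 → ℝ) (g i)) +
      (∏ i, (![0, 1, 0] : Fin 3 → ℝ) (g i)) + (∏ i, (![0, 0, 1] : Fin 3 → ℝ) (g i)) := by
  classical
  rcases n with _ | n
  · simp only [Finset.univ_eq_empty, Finset.prod_empty]; norm_num
  have key : ∀ w : Fin 3 → ℝ, (∀ c, w c = 0 ∨ w c = 1) →
      (∏ i, w (g i)) = if ∀ i, w (g i) = 1 then 1 else 0 := by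
    intro w hw
    split_ifs with h
    · exact Finset.prod_eq_one fun i _ => h i
    · push Not at h
      obtain ⟨i, hi⟩ := h
      exact Finset.prod_eq_zero (Finset.mem_univ i) ((hw _).resolve_right hi)
  have e : ∀ a b c : Bool, ∀ x : Fin 3, (![bif a then 1 else 0, bif b then 1 else 0, bif c then 1 else 0] : Fin 3 → ℝ) x = 1 ↔
      (x = 0 ∧ a = true ∨ x = 1 ∧ b = true ∨ x = 2 ∧ c = true) := by
    intro a b c x
    fin_cases x <;> cases a <;> cases b <;> cases c <;> simp
  have P : ∀ a b c : Bool, (∏ i, (![bif a then 1 else 0, bif b then 1 else 0, bif c then 1 else 0] : Fin 3 → ℝ) (g i)) =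
      if ∀ i, (g i = 0 ∧ a = true ∨ g i = 1 ∧ b = true ∨ g i = 2 ∧ c = true) then 1 else 0 := by
    intro a b c
    rw [key]
    · simp only [e]
    · intro x
      fin_cases x <;> cases a <;> cases b <;> cases c <;> simp
  have p110 := P true true false
  have p101 := P true false true
  have p011 := P false true true
  have p111 := P true true true
  have p100 := P true false false
  have p010 := P false true false
  have p001 := P false false true
  simp only [cond_true, cond_false] at p110 p101 p011 p111 p100 p010 p001
  rw [p110, p101, p011, p111, p100, p010, p001]
  have h3 : ∀ x : Fin 3, x = 0 ∨ x = 1 ∨ x = 2 := by decide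
  simp only [and_true, Bool.false_eq_true, and_false, or_false, false_or, h3, implies_true, if_true]
  have q : ∀ x y z : Fin 3, (∀ t : Fin 3, t = x ∨ t = y ∨ t = z) → x ≠ y → x ≠ z → y ≠ z →
      (∀ i, g i = x ∨ g i = y) → (∀ i, g i = x ∨ g i = z) → ∀ i, g i = x := by
    intro x y z _ _ _ h h1 h2 i
    rcases h1 i with h1 | h1
    · exact h1
    · rcases h2 i with h2 | h2
      · exact h2
      · exact absurd (h1.symm.trans h2) h
  have q0 := q 0 1 2 (by decide) (by decide) (by decide) (by decide)
  have q1 := q 1 0 2 (by decide) (by decide) (by decide) (by decide)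
  have q2 := q 2 0 1 (by decide) (by decide) (by decide) (by decide)
  have s1 : (∀ i, g i = 1 ∨ g i = 0) ↔ ∀ i, g i = 0 ∨ g i = 1 := by simp only [or_comm]
  have s2 : (∀ i, g i = 2 ∨ g i = 0) ↔ ∀ i, g i = 0 ∨ g i = 2 := by simp only [or_comm]
  have s3 : (∀ i, g i = 2 ∨ g i = 1) ↔ ∀ i, g i = 1 ∨ g i = 2 := by simp only [or_comm]
  rw [s1] at q1
  rw [s2, s3] at q2
  split_ifs <;> first | (norm_num; done) | (exfalso; tauto)

theorem det_superadditive_three {n : ℕ} (A B C : Matrix (Fin n) (Fin n) ℂ)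
    (hA : A.PosSemidef) (hB : B.PosSemidef) (hC : C.PosSemidef) :
    (A + B).det + (A + C).det + (B + C).det ≤
      (A + B + C).det + A.det + B.det + C.det := by
  classical
  have hT : ∀ c : Fin 3, ∃ (m : ℕ) (v : Fin m → Fin n → ℂ),
      (![A, B, C] : Fin 3 → Matrix (Fin n) (Fin n) ℂ) c =
        ∑ i, Matrix.vecMulVec (v i) (star (v i)) := by
    intro c
    fin_cases c
    · exact Matrix.posSemidef_iff_eq_sum_vecMulVec.mp hA
    · exact Matrix.posSemidef_iff_eq_sum_vecMulVec.mp hB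
    · exact Matrix.posSemidef_iff_eq_sum_vecMulVec.mp hC
  choose m v hv using hT
  have main : ∀ w : Fin 3 → ℝ, (n.factorial : ℂ) *
      ((w 0 : ℂ) • A + (w 1 : ℂ) • B + (w 2 : ℂ) • C).det =
      ((∑ f : Fin n → (Σ c : Fin 3, Fin (m c)), (∏ i, w (f i).1) *
        Complex.normSq (Matrix.det (fun i j => v (f i).1 (f i).2 j)) : ℝ) : ℂ) := by
    intro w
    rw [cauchy_binet_fun (κ := Σ c : Fin 3, Fin (m c)) (fun k => (w k.1 : ℂ))
      (fun k => v k.1 k.2)]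
    · push_cast
      refine Finset.sum_congr rfl fun f _ => ?_
      rw [← Complex.mul_conj]
      rfl
    · intro i j
      have a0 := congrFun (congrFun (hv 0) i) j
      have a1 := congrFun (congrFun (hv 1) i) j
      have a2 := congrFun (congrFun (hv 2) i) j
      simp only [Matrix.sum_apply, Matrix.vecMulVec_apply, Pi.star_apply] at a0 a1 a2
      rw [Fintype.sum_sigma, Fin.sum_univ_three]
      simp only [← Finset.mul_sum]
      rw [← a0, ← a1, ← a2]
      simp only [Matrix.add_apply, Matrix.smul_apply, smul_eq_mul]; rfl
  have r110 := main ![1, 1, 0]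
  have r101 := main ![1, 0, 1]
  have r011 := main ![0, 1, 1]
  have r111 := main ![1, 1, 1]
  have r100 := main ![1, 0, 0]
  have r010 := main ![0, 1, 0]
  have r001 := main ![0, 0, 1]
  have hpos : (0 : ℂ) < (n.factorial : ℂ) := by exact_mod_cast n.factorial_pos
  refine le_of_mul_le_mul_left ?_ hpos
  have t : ∀ a b c : ℝ, (((![a, b, c] : Fin 3 → ℝ) 0 : ℝ) : ℂ) = a ∧
    (((![a, b, c] : Fin 3 → ℝ) 1 : ℝ) : ℂ) = b ∧ (((![a, b, c] : Fin 3 → ℝ) 2 : ℝ) : ℂ) = c :=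
    fun a b c => ⟨rfl, rfl, rfl⟩
  rw [(t _ _ _).1, (t _ _ _).2.1, (t _ _ _).2.2] at r110 r101 r011 r111 r100 r010 r001
  simp only [Complex.ofReal_zero, Complex.ofReal_one, one_smul, zero_smul, add_zero,
    zero_add] at r110 r101 r011 r111 r100 r010 r001
  simp only [mul_add]
  rw [r110, r101, r011, r111, r100, r010, r001]
  simp only [← Complex.ofReal_add]
  rw [Complex.real_le_real]
  simp only [← Finset.sum_add_distrib, ← add_mul]
  exact Finset.sum_le_sum fun f _ => mul_le_mul_of_nonneg_right
    (weight_ineq fun i => (f i).1) (Complex.normSq_nonneg _)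
end

section
/- Let A, B, C be n×n positive semidefinite complex matrices. Then det(A+B+C) + det(C) ≥ det(A+C) + det(B+C). -/
open Matrix
open scoped ComplexOrder

/-- Expansion of `det (Mᴴ diag(w) M)` by rows. -/
lemma det_expand {n : ℕ} {ι : Type} [Fintype ι] (M N : Matrix ι (Fin n) ℂ) (w : ι → ℂ) :
    (Matrix.of fun i j => ∑ k, w k * N k i * M k j).det
      = ∑ f : Fin n → ι, (∏ i, w (f i)) * (∏ i, N (f i) i) * (M.submatrix f id).det := by
  have h := (detRowAlternating : (Fin n → ℂ) [⋀^Fin n]→ₗ[ℂ] ℂ).toMultilinearMap.map_sum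
    (fun (i : Fin n) (k : ι) => (w k * N k i) • M k)
  have e : (Matrix.of fun i j => ∑ k, w k * N k i * M k j)
      = fun i => ∑ k, (w k * N k i) • M k := by
    ext i j
    simp [Finset.sum_apply]
  rw [e]
  refine h.trans (Finset.sum_congr rfl fun f _ => ?_)
  rw [MultilinearMap.map_smul_univ, Finset.prod_mul_distrib]
  rfl

/-- Weighted Cauchy–Binet formula, summed over all functions. -/
lemma cauchy_binet {n : ℕ} {ι : Type} [Fintype ι] (M N : Matrix ι (Fin n) ℂ) (w : ι → ℂ) :
    (n.factorial : ℂ) * (Matrix.of fun i j => ∑ k, w k * N k i * M k j).det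
      = ∑ f : Fin n → ι, (∏ i, w (f i)) *
          ((N.submatrix f id).det * (M.submatrix f id).det) := by
  have key : ∀ σ : Equiv.Perm (Fin n),
      (∑ f : Fin n → ι, (∏ i, w (f i)) * (∏ i, N (f i) i) * (M.submatrix f id).det)
      = ∑ f : Fin n → ι, (∏ i, w (f i)) *
        (((Equiv.Perm.sign σ : ℤ) : ℂ) * ∏ i, N (f (σ i)) i) * (M.submatrix f id).det := by
    intro σ
    symm
    refine Fintype.sum_equiv (Equiv.arrowCongr σ.symm (Equiv.refl ι)) _ _ fun f => ?_
    have h1 : (M.submatrix (f ∘ σ) id).det = ((Equiv.Perm.sign σ : ℤ) : ℂ) *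
        (M.submatrix f id).det := by
      rw [← det_permute]; rfl
    have h2 : ∏ i, w (f (σ i)) = ∏ i, w (f i) := Equiv.prod_comp σ (fun i => w (f i))
    have h3 : (Equiv.arrowCongr σ.symm (Equiv.refl ι)) f = f ∘ σ := by
      ext i; simp
    rw [h3, h1]
    simp only [Function.comp, h2]
    ring
  have h4 : (n.factorial : ℂ) * (Matrix.of fun i j => ∑ k, w k * N k i * M k j).det
      = ∑ _σ : Equiv.Perm (Fin n), (Matrix.of fun i j => ∑ k, w k * N k i * M k j).det := by
    simp [Finset.card_univ, Fintype.card_perm]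
  rw [h4]
  rw [Finset.sum_congr rfl fun σ _ => (det_expand M N w).trans (key σ), Finset.sum_comm]
  refine Finset.sum_congr rfl fun f _ => ?_
  rw [← Finset.sum_mul, ← Finset.mul_sum, ← mul_assoc, det_apply' (N.submatrix f id)]
  rfl

lemma prod_zero_one {n : ℕ} (x : Fin n → ℂ) (h : ∀ i, x i = 0 ∨ x i = 1) :
    ∏ i, x i = 0 ∨ ∏ i, x i = 1 := by
  by_cases h0 : ∃ i, x i = 0
  · obtain ⟨i, hi⟩ := h0
    exact Or.inl (Finset.prod_eq_zero (Finset.mem_univ i) hi)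
  · push Not at h0
    exact Or.inr (Finset.prod_eq_one fun i _ => (h i).resolve_left (h0 i))

open scoped MatrixOrder in
lemma exists_factor {n : ℕ} {A : Matrix (Fin n) (Fin n) ℂ} (hA : A.PosSemidef) :
    ∃ X : Matrix (Fin n) (Fin n) ℂ, A = Xᴴ * X := by
  obtain ⟨X, hX⟩ := CStarAlgebra.nonneg_iff_eq_star_mul_self.mp hA.nonneg
  exact ⟨X, hX⟩

theorem det_three_term {n : ℕ} (A B C : Matrix (Fin n) (Fin n) ℂ)
    (hA : A.PosSemidef) (hB : B.PosSemidef) (hC : C.PosSemidef) :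
    (A + C).det + (B + C).det ≤ (A + B + C).det + C.det := by
  obtain ⟨X, hX⟩ := exists_factor hA
  obtain ⟨Y, hY⟩ := exists_factor hB
  obtain ⟨Z, hZ⟩ := exists_factor hC
  let M : Matrix (Fin 3 × Fin n) (Fin n) ℂ := fun k i => ![X, Y, Z] k.1 k.2 i
  let N : Matrix (Fin 3 × Fin n) (Fin n) ℂ := fun k i => star (M k i)
  have m0 : ∀ a i, M (0, a) i = X a i := fun _ _ => rfl
  have m1 : ∀ a i, M (1, a) i = Y a i := fun _ _ => rfl
  have m2 : ∀ a i, M (2, a) i = Z a i := fun _ _ => rfl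
  have n0 : ∀ k i, N k i = star (M k i) := fun _ _ => rfl
  have hN : ∀ f : Fin n → Fin 3 × Fin n,
      (N.submatrix f id).det = star (M.submatrix f id).det := by
    intro f
    rw [← det_conjTranspose, ← det_transpose]
    rfl
  clear_value N M
  have hv : ∀ v : Fin 3 → ℂ, (n.factorial : ℂ) * (v 0 • A + v 1 • B + v 2 • C).det
      = ∑ f : Fin n → Fin 3 × Fin n, (∏ i, v (f i).1) *
          (star (M.submatrix f id).det * (M.submatrix f id).det) := by
    intro v
    have := cauchy_binet M N (fun k => v k.1)
    simp only [hN] at this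
    rw [← this]
    congr 2
    ext i j
    simp [hX, hY, hZ, Fintype.sum_prod_type, Fin.sum_univ_three, m0, m1, m2, n0, Matrix.mul_apply,
      Finset.mul_sum, mul_assoc]
  have e1 := hv ![1, 0, 1]
  have e2 := hv ![0, 1, 1]
  have e3 := hv ![1, 1, 1]
  have e4 := hv ![0, 0, 1]
  simp only [cons_val_zero, cons_val_one, cons_val, one_smul, zero_smul, add_zero,
    zero_add] at e1 e2 e3 e4
  have hpos : (0 : ℂ) < (n.factorial : ℂ) := by exact_mod_cast n.factorial_pos
  refine le_of_mul_le_mul_left ?_ hpos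
  rw [mul_add, mul_add, e1, e2, e3, e4, ← Finset.sum_add_distrib, ← Finset.sum_add_distrib]
  refine Finset.sum_le_sum fun f _ => ?_
  rw [← add_mul, ← add_mul]
  refine mul_le_mul_of_nonneg_right ?_ (star_mul_self_nonneg _)
  have p1 : ∏ i, (![1, 1, 1] : Fin 3 → ℂ) (f i).1 = 1 := by
    refine Finset.prod_eq_one fun i _ => ?_
    generalize (f i).1 = k
    fin_cases k <;> rfl
  have p2 : ∏ i, (![0, 0, 1] : Fin 3 → ℂ) (f i).1
      = (∏ i, (![1, 0, 1] : Fin 3 → ℂ) (f i).1) * ∏ i, (![0, 1, 1] : Fin 3 → ℂ) (f i).1 := by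
    rw [← Finset.prod_mul_distrib]
    refine Finset.prod_congr rfl fun i _ => ?_
    generalize (f i).1 = k
    fin_cases k <;> simp
  rw [p1, p2]
  have q1 := prod_zero_one (fun i => (![1, 0, 1] : Fin 3 → ℂ) (f i).1) (by
    intro i
    generalize (f i).1 = k
    fin_cases k <;> simp)
  have q2 := prod_zero_one (fun i => (![0, 1, 1] : Fin 3 → ℂ) (f i).1) (by
    intro i
    generalize (f i).1 = k
    fin_cases k <;> simp)
  rcases q1 with q1 | q1 <;> rcases q2 with q2 | q2 <;> rw [q1, q2] <;> norm_num
end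

section
/- Let A = [A_ij] ∈ M_m(M_n) be a positive semidefinite block matrix. Then the second partial determinant det₂(A) = [det A_ij]_{i,j=1}^m is a positive semidefinite m×m matrix. -/
open Matrix
open scoped ComplexOrder

/-- A symmetrized form of the Cauchy–Binet identity. -/
lemma cauchyBinet_aux {K N : Type*} [Fintype K] [DecidableEq K] [Fintype N] [DecidableEq N]
    (P : Matrix N K ℂ) (Q : Matrix K N ℂ) :
    ∑ f : N → K, (P.submatrix id f).det * (Q.submatrix f id).det
      = (Fintype.card (Equiv.Perm N) : ℂ) * (P * Q).det := by
  have h1 : ∀ σ : Equiv.Perm N, (P * Q).det =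
      ∑ τ : Equiv.Perm N, ∑ f : N → K, ((Equiv.Perm.sign σ : ℤ) : ℂ) * (∏ k, P (σ k) (f k)) *
        (((Equiv.Perm.sign τ : ℤ) : ℂ) * ∏ k, Q (f k) (τ k)) := by
    intro σ
    have h2 : (P * Q).det = ((Equiv.Perm.sign σ : ℤ) : ℂ) * ((P * Q).submatrix σ id).det := by
      rw [det_permute, ← mul_assoc, ← Int.cast_mul, ← Units.val_mul, Int.units_mul_self]
      simp
    rw [h2, ← det_transpose, det_apply', Finset.mul_sum]
    refine Finset.sum_congr rfl fun τ _ => ?_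
    simp only [transpose_apply, submatrix_apply, id, mul_apply]
    rw [Finset.prod_univ_sum, Finset.mul_sum, Finset.mul_sum, Fintype.piFinset_univ]
    refine Finset.sum_congr rfl fun f _ => ?_
    rw [Finset.prod_mul_distrib]
    ring
  have h3 : ∑ σ : Equiv.Perm N, (P * Q).det
      = (Fintype.card (Equiv.Perm N) : ℂ) * (P * Q).det := by
    simp
  rw [← h3, Finset.sum_congr rfl fun σ _ => h1 σ]
  have h4 : ∀ f : N → K, (P.submatrix id f).det * (Q.submatrix f id).det =
      ∑ σ : Equiv.Perm N, ∑ τ : Equiv.Perm N,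
        ((Equiv.Perm.sign σ : ℤ) : ℂ) * (∏ k, P (σ k) (f k)) *
        (((Equiv.Perm.sign τ : ℤ) : ℂ) * ∏ k, Q (f k) (τ k)) := by
    intro f
    rw [← det_transpose (Q.submatrix f id), det_apply', det_apply', Finset.sum_mul_sum]
    rfl
  rw [Finset.sum_congr rfl fun f _ => h4 f, Finset.sum_comm]
  refine Finset.sum_congr rfl fun σ _ => ?_
  rw [Finset.sum_comm]

theorem det2_posSemidef {m n : ℕ} (A : Matrix (Fin m × Fin n) (Fin m × Fin n) ℂ)
    (hA : A.PosSemidef) : (det2 A).PosSemidef := by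
  obtain ⟨B, rfl⟩ : ∃ B : Matrix (Fin m × Fin n) (Fin m × Fin n) ℂ, A = Bᴴ * B := by
    open scoped MatrixOrder in
    exact CStarAlgebra.nonneg_iff_eq_star_mul_self.mp hA.nonneg
  let V : Matrix (Fin n → Fin m × Fin n) (Fin m) ℂ :=
    Matrix.of fun f j => (B.submatrix f (fun r => (j, r))).det
  have key : det2 (Bᴴ * B) = ((Fintype.card (Equiv.Perm (Fin n)) : ℂ)⁻¹) • (Vᴴ * V) := by
    have hc : (Fintype.card (Equiv.Perm (Fin n)) : ℂ) ≠ 0 := by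
      exact_mod_cast Fintype.card_ne_zero
    rw [eq_inv_smul_iff₀ hc]
    ext i j
    have := cauchyBinet_aux (Bᴴ.submatrix (fun r => (i, r)) id) (B.submatrix id (fun r => (j, r)))
    rw [Matrix.smul_apply, smul_eq_mul, mul_apply]
    refine Eq.trans this.symm ?_
    refine Finset.sum_congr rfl fun f _ => ?_
    simp only [V, conjTranspose_apply, of_apply]
    rw [← det_conjTranspose]
    rfl
  rw [key]
  refine (posSemidef_conjTranspose_mul_self V).smul ?_
  rw [inv_nonneg]
  exact Nat.cast_nonneg _
end

section
/- Let A = [A_ij] ∈ M_m(M_n) be a positive semidefinite block matrix. Then the first partial determinant det₁(A) = [det G_rs]_{r,s=1}^n is a positive semidefinite n×n matrix, where G_rs is the m×m matrix with entries G_rs(i,j) = A((i,r),(j,s)). -/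
open Matrix
open scoped ComplexOrder

/-- The first partial determinant of a block matrix `A ∈ M_m(M_n)`:
the `n × n` matrix `[det G_rs]` where `G_rs (i, j) = A (i, r) (j, s)`. -/
noncomputable def det1 {m n : ℕ} (A : Matrix (Fin m × Fin n) (Fin m × Fin n) ℂ) :
    Matrix (Fin n) (Fin n) ℂ :=
  Matrix.of fun r s => (Matrix.of fun i j => A (i, r) (j, s)).det

open Matrix in
lemma det_prod_sum_aux {m : ℕ} {K : Type*} [Fintype K] [DecidableEq K]
    (P Q : Matrix K (Fin m) ℂ) :
    ∑ f : Fin m → K, (Matrix.of fun i j => P (f i) j).det * (Matrix.of fun i j => Q (f i) j).det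
      = (m.factorial : ℂ) * (Pᵀ * Q).det := by
  have h1 : ∀ (M : Matrix (Fin m) (Fin m) ℂ),
      M.det = ∑ σ : Equiv.Perm (Fin m), ((Equiv.Perm.sign σ : ℤ) : ℂ) * ∏ i, M i (σ i) := by
    intro M
    rw [← Matrix.det_transpose, Matrix.det_apply']
    rfl
  have h2 : ∀ σ : Equiv.Perm (Fin m), (Pᵀ * Q).det =
      ∑ τ : Equiv.Perm (Fin m), ((Equiv.Perm.sign σ : ℤ) : ℂ) *
        (((Equiv.Perm.sign τ : ℤ) : ℂ) * ∏ i, (Pᵀ * Q) (σ i) (τ i)) := by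
    intro σ
    have := Matrix.det_permute σ (Pᵀ * Q)
    rw [← Finset.mul_sum]
    have h3 := h1 ((Pᵀ * Q).submatrix σ id)
    simp only [Matrix.submatrix_apply, id] at h3
    rw [← h3, this, ← mul_assoc]
    have : (((Equiv.Perm.sign σ : ℤ) : ℂ)) * ((Equiv.Perm.sign σ : ℤ) : ℂ) = 1 := by
      rw [← Int.cast_mul, ← Units.val_mul, Int.units_mul_self]; simp
    rw [this, one_mul]
  have h4 : (m.factorial : ℂ) * (Pᵀ * Q).det
      = ∑ σ : Equiv.Perm (Fin m), (Pᵀ * Q).det := by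
    simp [Fintype.card_perm]
  rw [h4, Finset.sum_congr rfl (fun σ _ => h2 σ)]
  simp only [h1 (Matrix.of _), Finset.sum_mul_sum, Matrix.of_apply]
  rw [Finset.sum_comm]
  refine Finset.sum_congr rfl fun σ _ => ?_
  rw [Finset.sum_comm]
  refine Finset.sum_congr rfl fun τ _ => ?_
  simp only [Matrix.mul_apply, Matrix.transpose_apply]
  rw [Finset.prod_univ_sum, Fintype.piFinset_univ, Finset.mul_sum, Finset.mul_sum]
  refine Finset.sum_congr rfl fun f _ => ?_
  rw [Finset.prod_mul_distrib]
  ring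

theorem det1_posSemidef {m n : ℕ} (A : Matrix (Fin m × Fin n) (Fin m × Fin n) ℂ)
    (hA : A.PosSemidef) : (det1 A).PosSemidef := by
  obtain ⟨k, v, hv⟩ := Matrix.posSemidef_iff_eq_sum_vecMulVec.mp hA
  let D : Matrix (Fin m → Fin k) (Fin n) ℂ :=
    Matrix.of fun f r => (Matrix.of fun i j => star (v (f i) (j, r))).det
  have hD : det1 A = ((m.factorial : ℂ)⁻¹) • (Dᴴ * D) := by
    ext r s
    have h := det_prod_sum_aux (m := m) (K := Fin k) (Matrix.of fun l j => v l (j, r))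
      (Matrix.of fun l j => star (v l (j, s)))
    have hG : (Matrix.of fun l j => v l (j, r))ᵀ * (Matrix.of fun l j => star (v l (j, s)))
        = (Matrix.of fun i j => A (i, r) (j, s)) := by
      ext i j
      simp [hv, Matrix.mul_apply, Matrix.sum_apply, Matrix.vecMulVec_apply]
    rw [hG] at h
    have hm : (m.factorial : ℂ) ≠ 0 := by exact_mod_cast m.factorial_ne_zero
    have hs : ∀ f : Fin m → Fin k, star (D f r) = (Matrix.of fun i j => v (f i) (j, r)).det := by
      intro f
      simp only [D, Matrix.of_apply]
      rw [← Matrix.det_conjTranspose, ← Matrix.det_transpose]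
      congr 1
      ext i j
      simp
    rw [Matrix.smul_apply, Matrix.mul_apply, smul_eq_mul, eq_inv_mul_iff_mul_eq₀ hm]
    simp only [Matrix.conjTranspose_apply, hs]
    exact h.symm
  rw [hD]
  refine (Matrix.posSemidef_conjTranspose_mul_self D).smul ?_
  rw [← Complex.ofReal_natCast, ← Complex.ofReal_inv]
  exact_mod_cast (by positivity : (0:ℝ) ≤ (m.factorial : ℝ)⁻¹)
end

section
/- Let u, v, w be nonzero vectors in a complex inner product space. Then Φ(u,v) ≤ Φ(u,w) + Φ(w,v), where Φ(x,y) := arccos( Re⟨x,y⟩ / (‖x‖‖y‖) ). (Krein's inequality.) -/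
open scoped InnerProductSpace

/-- The angle `Φ(x,y) = arccos(Re⟨x,y⟩ / (‖x‖‖y‖))` between two vectors in a complex
inner product space. -/
noncomputable def Phi {E : Type*} [NormedAddCommGroup E] [InnerProductSpace ℂ E]
    (x y : E) : ℝ :=
  Real.arccos ((⟪x, y⟫_ℂ).re / (‖x‖ * ‖y‖))

/-- Krein's inequality. -/
theorem krein_inequality {E : Type*} [NormedAddCommGroup E] [InnerProductSpace ℂ E]
    (u v w : E) (hu : u ≠ 0) (hv : v ≠ 0) (hw : w ≠ 0) :
    Phi u v ≤ Phi u w + Phi w v := by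
  letI : InnerProductSpace ℝ E := InnerProductSpace.rclikeToReal ℂ E
  exact InnerProductGeometry.angle_le_angle_add_angle u w v
end
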